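/- arXiv:2009.08419 — 6 statements merged into one kernel-verified Lean document; each statement's English description precedes it below -/
import Mathlib

section
/- Let c₁, c₂ be coprime positive integers and let a be any integer. Then G(a/(c₁c₂)) = G(a·c₂/c₁) · G(a·c₁/c₂). -/
open Complex Real BigOperators

/-- The quadratic Gauss sum `G(a/c) = ∑_{x=0}^{c-1} e^{2πi a x² / c}`. -/
noncomputable def quadGaussSum (a : ℤ) (c : ℕ) : ℂ :=
  ∑ x ∈ Finset.range c, Complex.exp (2 * Real.pi * Complex.I * a * (x : ℂ) ^ 2 / c)

/-- The summand of the quadratic Gauss sum depends only on `x` modulo `c`. -/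
lemma exp_quadratic_mod (a : ℤ) (c : ℕ) (hc : 0 < c) (x : ℕ) :
    Complex.exp (2 * Real.pi * Complex.I * a * ((x % c : ℕ) : ℂ) ^ 2 / c) =
      Complex.exp (2 * Real.pi * Complex.I * a * (x : ℂ) ^ 2 / c) := by
  have : NeZero c := ⟨hc.ne'⟩
  have key (n : ℕ) : Complex.exp (2 * Real.pi * Complex.I * a * (n : ℂ) ^ 2 / c) =
      ZMod.stdAddChar (N := c) (a * (n : ZMod c) ^ 2) := by
    have := ZMod.stdAddChar_coe (N := c) (a * (n : ℤ) ^ 2)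
    push_cast at this
    rw [this, mul_assoc (2 * Real.pi * Complex.I)]
  rw [key, key, ZMod.natCast_mod]

/-- The quadratic exponential at `c₂ * x + c₁ * y` with modulus `c₁ * c₂` splits as a product. -/
lemma exp_quadratic_add (a : ℤ) (c₁ c₂ : ℕ) (hc₁ : 0 < c₁) (hc₂ : 0 < c₂) (x y : ℕ) :
    Complex.exp (2 * Real.pi * Complex.I * a * ((c₂ * x + c₁ * y : ℕ) : ℂ) ^ 2 /
        (c₁ * c₂ : ℕ)) =
      Complex.exp (2 * Real.pi * Complex.I * (a * c₂ : ℤ) * (x : ℂ) ^ 2 / c₁) *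
        Complex.exp (2 * Real.pi * Complex.I * (a * c₁ : ℤ) * (y : ℂ) ^ 2 / c₂) := by
  have h₁ : (c₁ : ℂ) ≠ 0 := by exact_mod_cast hc₁.ne'
  have h₂ : (c₂ : ℂ) ≠ 0 := by exact_mod_cast hc₂.ne'
  rw [← Complex.exp_add, Complex.exp_eq_exp_iff_exists_int]
  refine ⟨2 * a * x * y, ?_⟩
  push_cast
  field_simp
  ring

/-- For coprime moduli, `c₂ * x + c₁ * y` modulo `c₁ * c₂` determines `x` modulo `c₁`. -/
lemma modEq_of_mul_add_mul_modEq {c₁ c₂ x y x' y' : ℕ} (h : Nat.Coprime c₁ c₂)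
    (e : c₂ * x + c₁ * y ≡ c₂ * x' + c₁ * y' [MOD c₁ * c₂]) : x ≡ x' [MOD c₁] := by
  have e₁ := e.of_mul_right c₂
  refine Nat.ModEq.cancel_left_of_coprime h (c := c₂) ?_
  simpa [Nat.ModEq] using e₁

/-- for coprime positive `c₁, c₂`,
`G(a/(c₁c₂)) = G(a·c₂/c₁) · G(a·c₁/c₂)`. -/
theorem quadGaussSum_mul (c₁ c₂ : ℕ) (hc₁ : 0 < c₁) (hc₂ : 0 < c₂)
    (h : Nat.Coprime c₁ c₂) (a : ℤ) :
    quadGaussSum a (c₁ * c₂) = quadGaussSum (a * c₂) c₁ * quadGaussSum (a * c₁) c₂ := by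
  rw [quadGaussSum, quadGaussSum, quadGaussSum, Finset.sum_mul_sum, ← Finset.sum_product']
  symm
  have hc : 0 < c₁ * c₂ := Nat.mul_pos hc₁ hc₂
  have hmaps : Set.MapsTo (fun p : ℕ × ℕ => (c₂ * p.1 + c₁ * p.2) % (c₁ * c₂))
      (Finset.range c₁ ×ˢ Finset.range c₂ : Finset (ℕ × ℕ)) (Finset.range (c₁ * c₂)) :=
    fun p _ => Finset.mem_coe.2 (Finset.mem_range.2 (Nat.mod_lt _ hc))
  have hinj : Set.InjOn (fun p : ℕ × ℕ => (c₂ * p.1 + c₁ * p.2) % (c₁ * c₂))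
      (Finset.range c₁ ×ˢ Finset.range c₂ : Finset (ℕ × ℕ)) := by
    rintro ⟨x, y⟩ hp ⟨x', y'⟩ hq e
    simp only [Finset.mem_coe, Finset.mem_product, Finset.mem_range] at hp hq
    have e' : c₁ * y + c₂ * x ≡ c₁ * y' + c₂ * x' [MOD c₂ * c₁] := by
      rw [add_comm (c₁ * y), add_comm (c₁ * y'), mul_comm c₂ c₁]
      exact e
    exact Prod.ext ((modEq_of_mul_add_mul_modEq h e).eq_of_lt_of_lt hp.1 hq.1)
      ((modEq_of_mul_add_mul_modEq h.symm e').eq_of_lt_of_lt hp.2 hq.2)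
  refine Finset.sum_nbij _ hmaps hinj
    (Finset.surjOn_of_injOn_of_card_le _ hmaps hinj (by simp)) fun p _ => ?_
  rw [exp_quadratic_mod a _ hc, exp_quadratic_add a c₁ c₂ hc₁ hc₂]
end

section
/- Let k ≥ 2 be an even integer and let a be an odd integer. Then G(a/2^k) = 2^{k/2} (1 + e^{2πi a/4}). -/
open Complex Real BigOperators

theorem Finset.sum_range_two_mul_eq_even_add_odd {R : Type*} [AddCommMonoid R] (f : ℕ → R) (n : ℕ) :
    ∑ x ∈ Finset.range (2 * n), f x =
      ∑ y ∈ Finset.range n, f (2 * y) + ∑ y ∈ Finset.range n, f (2 * y + 1) := by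
  rw [← Finset.sum_add_distrib]
  induction n with
  | zero => simp
  | succ n ih =>
    rw [show 2 * (n + 1) = 2 * n + 1 + 1 by ring, Finset.sum_range_succ, Finset.sum_range_succ, ih,
      Finset.sum_range_succ, add_assoc]

theorem Finset.sum_range_two_mul_of_periodic {R : Type*} [NonAssocSemiring R] {f : ℕ → R} {n : ℕ}
    (hf : Function.Periodic f n) :
    ∑ x ∈ Finset.range (2 * n), f x = 2 * ∑ x ∈ Finset.range n, f x := by
  rw [two_mul n, Finset.sum_range_add, two_mul]
  congr 1
  exact Finset.sum_congr rfl fun x _ => by rw [add_comm, hf x]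

theorem Finset.sum_range_two_mul_of_antiperiodic {R : Type*} [AddCommGroup R] {f : ℕ → R} {n : ℕ}
    (hf : Function.Antiperiodic f n) :
    ∑ x ∈ Finset.range (2 * n), f x = 0 := by
  rw [two_mul n, Finset.sum_range_add, ← Finset.sum_add_distrib]
  exact Finset.sum_eq_zero fun x _ => by rw [add_comm n, hf x, add_neg_cancel]

/-- If `4 ∣ n` and `a` is odd, the odd residues contribute nothing to `G(a/4n)`, and the even ones
contribute `2 G(a/n)`. -/
theorem quadGaussSum_four_mul {a : ℤ} (ha : Odd a) {n : ℕ} (hn : n ≠ 0) (h4 : 4 ∣ n) :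
    quadGaussSum a (4 * n) = 2 * quadGaussSum a n := by
  have hn' : (n : ℂ) ≠ 0 := Nat.cast_ne_zero.mpr hn
  unfold quadGaussSum
  rw [show 4 * n = 2 * (2 * n) by ring, Finset.sum_range_two_mul_eq_even_add_odd,
    ← Finset.sum_range_two_mul_of_periodic]
  · rw [add_eq_left.mpr]
    · refine Finset.sum_congr rfl fun y _ => ?_
      congr 1
      push_cast
      field_simp
    · apply Finset.sum_range_two_mul_of_periodic (n := n) (fun y => ?_) |>.trans
      · obtain ⟨m, rfl⟩ := h4
        obtain ⟨b, rfl⟩ := ha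
        rw [show 4 * m = 2 * (2 * m) by ring, Finset.sum_range_two_mul_of_antiperiodic, mul_zero]
        intro y
        have hm : (m : ℂ) ≠ 0 := fun h => hn' (by simp [h])
        rw [← Complex.exp_add_pi_mul_I, Complex.exp_eq_exp_iff_exists_int]
        refine ⟨(2 * b + 1) * (m + y) + b, ?_⟩
        push_cast
        field_simp
        ring
      · rw [Complex.exp_eq_exp_iff_exists_int]
        refine ⟨a * (2 * y + 1 + n), ?_⟩
        push_cast
        field_simp
        ring
  · intro y
    rw [Complex.exp_eq_exp_iff_exists_int]
    refine ⟨a * (2 * y + n), ?_⟩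
    push_cast
    field_simp
    ring

theorem quadGaussSum_four (a : ℤ) :
    quadGaussSum a 4 = 2 * (1 + Complex.exp (2 * Real.pi * Complex.I * a / 4)) := by
  have h0 : Complex.exp (2 * Real.pi * Complex.I * a * 2 ^ 2 / 4) = 1 :=
    Complex.exp_eq_one_iff.mpr ⟨a, by ring⟩
  have h1 : Complex.exp (2 * Real.pi * Complex.I * a * 3 ^ 2 / 4) =
      Complex.exp (2 * Real.pi * Complex.I * a / 4) :=
    Complex.exp_eq_exp_iff_exists_int.mpr ⟨2 * a, by push_cast; ring⟩
  simp only [quadGaussSum, Finset.sum_range_succ, Finset.sum_range_zero]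
  push_cast
  rw [h0, h1]
  simp only [ne_eq, OfNat.ofNat_ne_zero, not_false_eq_true, zero_pow, mul_zero, zero_div,
    Complex.exp_zero, one_pow, mul_one]
  ring

/-- for even `k ≥ 2` and odd `a`,
`G(a/2^k) = 2^{k/2} (1 + e^{2πi a / 4})`. -/
theorem quadGaussSum_two_pow_even (k : ℕ) (hk : 2 ≤ k) (hke : Even k)
    (a : ℤ) (ha : Odd a) :
    quadGaussSum a (2 ^ k) =
      (2 : ℂ) ^ (k / 2) * (1 + Complex.exp (2 * Real.pi * Complex.I * a / 4)) := by
  obtain ⟨j, rfl⟩ := hke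
  rw [← two_mul, Nat.mul_div_cancel_left j two_pos, pow_mul]
  norm_num only
  have hj : 1 ≤ j := by omega
  induction j, hj using Nat.le_induction with
  | base => rw [pow_one, pow_one, quadGaussSum_four]
  | succ j hj ih =>
    rw [pow_succ', quadGaussSum_four_mul ha (by positivity) (dvd_pow_self 4 (by omega)),
      ih (by omega), pow_succ']
    ring
end

section
/- Let q = q* q₀ with gcd(q*, q₀) = 1, let χ* be a primitive Dirichlet character modulo q*, and let χ be the Dirichlet character modulo q induced by χ* (so χ(n) = χ*(n) when gcd(n,q) = 1 and χ(n) = 0 otherwise). Let d | q and let a be an integer with gcd(a,d) = 1. Then S_χ(a,d,q) := ∑_{n mod q, n ≡ a (mod d)} χ(n) equals 0 unless q* | d, in which case S_χ(a,d,q) = (q/d) · χ*(a) · ∏_{p | q₀, p ∤ d} (1 − 1/p). -/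
open BigOperators

open Finset in
/-- The sum of a Dirichlet character over a residue class coprime to `d`, as a sum over units. -/
lemma DirichletCharacter.sum_range_residue_eq_sum_units {q d : ℕ} [NeZero q] (hd : d ∣ q)
    (χ : DirichletCharacter ℂ q) (a : ℤ) (v : (ZMod d)ˣ) (hv : (v : ZMod d) = a) :
    (∑ n ∈ range q, if (n : ℤ) % d = a % d then χ (n : ZMod q) else 0) =
      ∑ u : (ZMod q)ˣ with ZMod.unitsMap hd u = v, χ u := by
  rw [sum_filter]
  symm
  refine sum_of_injOn (fun u : (ZMod q)ˣ ↦ (u : ZMod q).val) ?_ ?_ ?_ ?_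
  · exact fun u _ w _ h ↦ Units.ext (ZMod.val_injective q h)
  · exact fun u _ ↦ by simpa using ZMod.val_lt (u : ZMod q)
  · intro n hn hn'
    rw [χ.map_nonunit, ite_self]
    rintro ⟨u, hu⟩
    exact hn' ⟨u, by simp, by simp [hu, ZMod.val_cast_of_lt (mem_range.1 hn)]⟩
  · intro u _
    have : ZMod.unitsMap hd u = v ↔ ((u : ZMod q).val : ℤ) % d = a % d := by
      rw [Units.ext_iff, ZMod.unitsMap_val, hv, ← Int.ModEq, ← ZMod.intCast_eq_intCast_iff]
      simp [ZMod.natCast_val]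
    simp [this]

open Finset in
lemma DirichletCharacter.sum_fiber_unitsMap_eq_zero {q d : ℕ} [NeZero q] (hd : d ∣ q)
    (χ : DirichletCharacter ℂ q) (hχ : ¬ χ.FactorsThrough d) (v : (ZMod d)ˣ) :
    ∑ u : (ZMod q)ˣ with ZMod.unitsMap hd u = v, χ u = 0 := by
  rw [factorsThrough_iff_ker_unitsMap hd, SetLike.not_le_iff_exists] at hχ
  obtain ⟨k, hk, hkχ⟩ := hχ
  have hk' : χ k ≠ 1 := fun h ↦ hkχ (by
    rw [MonoidHom.mem_ker, Units.ext_iff]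
    simpa using h)
  refine eq_zero_of_mul_eq_self_left hk' ?_
  rw [mul_sum]
  refine sum_equiv (Equiv.mulLeft k) (fun u ↦ ?_) (fun u _ ↦ by simp)
  simp [MonoidHom.mem_ker.1 hk]

open Finset in
lemma ZMod.totient_mul_card_fiber_unitsMap {q d : ℕ} [NeZero q] [NeZero d] (hd : d ∣ q)
    (v : (ZMod d)ˣ) :
    d.totient * #{u : (ZMod q)ˣ | ZMod.unitsMap hd u = v} = q.totient := by
  rw [← ZMod.card_units_eq_totient q, ← card_univ,
    card_eq_sum_card_fiberwise (s := univ) (f := ZMod.unitsMap hd) (t := univ) (by simp),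
    ← ZMod.card_units_eq_totient d, ← card_univ, ← smul_eq_mul, ← sum_const]
  exact sum_congr rfl fun w _ ↦ MonoidHom.card_fiber_eq_of_mem_range _
    (ZMod.unitsMap_surjective hd v) (ZMod.unitsMap_surjective hd w)

open Finset in
lemma Nat.totient_eq_mul_prod_primeFactors_not_dvd {q d : ℕ} (hq : q ≠ 0) (hd : d ∣ q) :
    (q.totient : ℚ) =
      d.totient * ((q / d : ℕ) * ∏ p ∈ q.primeFactors with ¬ p ∣ d, (1 - (p : ℚ)⁻¹)) := by
  have hd0 : d ≠ 0 := ne_zero_of_dvd_ne_zero hq hd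
  have hdiv : q.primeFactors.filter (· ∣ d) = d.primeFactors := by
    ext p
    simp only [mem_filter, Nat.mem_primeFactors]
    exact ⟨fun h ↦ ⟨h.1.1, h.2, hd0⟩, fun h ↦ ⟨⟨h.1, h.2.1.trans hd, hq⟩, h.2.1⟩⟩
  rw [Nat.totient_eq_mul_prod_factors, Nat.totient_eq_mul_prod_factors,
    ← prod_filter_mul_prod_filter_not q.primeFactors (· ∣ d), hdiv]
  nth_rewrite 1 [← Nat.mul_div_cancel' hd]
  push_cast
  ring

open Finset in
lemma ZMod.card_fiber_unitsMap {q d : ℕ} [NeZero q] (hd : d ∣ q) (v : (ZMod d)ˣ) :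
    (#{u : (ZMod q)ˣ | ZMod.unitsMap hd u = v} : ℚ) =
      (q / d : ℕ) * ∏ p ∈ q.primeFactors with ¬ p ∣ d, (1 - (p : ℚ)⁻¹) := by
  have : NeZero d := ⟨ne_zero_of_dvd_ne_zero (NeZero.ne q) hd⟩
  have hφ : (d.totient : ℚ) ≠ 0 := by
    exact_mod_cast (Nat.totient_pos.2 (NeZero.pos d)).ne'
  refine mul_left_cancel₀ hφ ?_
  rw [← Nat.totient_eq_mul_prod_primeFactors_not_dvd (NeZero.ne q) hd,
    ← ZMod.totient_mul_card_fiber_unitsMap hd v, Nat.cast_mul]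

/-- character sum `S_χ(a,d,q)` over `n mod q` with `n ≡ a (mod d)`,
for `χ` the character mod `q = q* q₀` induced by a primitive character `χ*` mod `q*`. -/
theorem char_sum_arith_progression (qstar q₀ : ℕ) (hqs : 0 < qstar) (hq₀ : 0 < q₀)
    (hcop : Nat.Coprime qstar q₀)
    (χstar : DirichletCharacter ℂ qstar) (hprim : χstar.IsPrimitive)
    (d : ℕ) (hdpos : 0 < d) (hd : d ∣ qstar * q₀)
    (a : ℤ) (ha : Int.gcd a (d : ℤ) = 1) :
    (∑ n ∈ Finset.range (qstar * q₀),
        if (n : ℤ) % d = a % d then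
          (DirichletCharacter.changeLevel (dvd_mul_right qstar q₀) χstar)
            ((n : ℕ) : ZMod (qstar * q₀))
        else 0) =
      if qstar ∣ d then
        ((qstar * q₀ / d : ℕ) : ℂ) * χstar ((a : ℤ) : ZMod qstar) *
          ∏ p ∈ q₀.primeFactors.filter fun p => ¬ p ∣ d, (1 - 1 / (p : ℂ))
      else 0 := by
  have : NeZero (qstar * q₀) := ⟨(Nat.mul_pos hqs hq₀).ne'⟩
  have hv := ZMod.coe_unitOfIsCoprime a (Int.isCoprime_iff_gcd_eq_one.2 ha)
  set v := ZMod.unitOfIsCoprime a (Int.isCoprime_iff_gcd_eq_one.2 ha)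
  rw [DirichletCharacter.sum_range_residue_eq_sum_units hd _ a v hv]
  split_ifs with h
  · have hval : ∀ u ∈ Finset.univ.filter fun u : (ZMod (qstar * q₀))ˣ ↦ ZMod.unitsMap hd u = v,
        DirichletCharacter.changeLevel (dvd_mul_right qstar q₀) χstar u = χstar (a : ZMod qstar) := by
      intro u hu
      have hu' : ZMod.unitsMap hd u = v := (Finset.mem_filter.1 hu).2
      have hcast := congrArg (ZMod.unitsMap h) hu'
      rw [← MonoidHom.comp_apply, ZMod.unitsMap_comp, Units.ext_iff, ZMod.unitsMap_val,
        ZMod.unitsMap_val, hv, ZMod.cast_intCast h] at hcast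
      rw [DirichletCharacter.changeLevel_eq_cast_of_dvd, hcast]
    have hprimes : (qstar * q₀).primeFactors.filter (fun p ↦ ¬ p ∣ d) =
        q₀.primeFactors.filter fun p ↦ ¬ p ∣ d := by
      rw [hcop.primeFactors_mul, Finset.filter_union, Finset.filter_eq_empty_iff.2,
        Finset.empty_union]
      exact fun p hp hpd ↦ hpd ((Nat.dvd_of_mem_primeFactors hp).trans h)
    have hcard := congrArg (Rat.cast : ℚ → ℂ) (ZMod.card_fiber_unitsMap hd v)
    rw [hprimes] at hcard
    push_cast at hcard
    rw [Finset.sum_congr rfl hval, Finset.sum_const, nsmul_eq_mul, hcard]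
    simp only [one_div]
    ring
  · refine DirichletCharacter.sum_fiber_unitsMap_eq_zero hd _ (fun hf ↦ h ?_) v
    have := DirichletCharacter.conductor_dvd_of_mem_conductorSet _ hf
    rwa [DirichletCharacter.conductor_changeLevel, hprim] at this
end

section
/- For every positive integer c and all integers a, b, one has T(a,b;c) = c · ∑_{t mod c, gcd(t,c)=1, b t ≡ a (mod c)} ∑_{x mod c} e^{2πi(t x² + a x)/c}. -/
open Complex Real BigOperators

/-- The additive character `e^{2πi z / c}` of modulus `c`. -/
noncomputable def eModC (c : ℕ) (z : ℤ) : ℂ :=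
  Complex.exp (2 * Real.pi * Complex.I * z / c)

/-- The Kloosterman sum `S(m,n;c) = ∑_{x mod c, (x,c)=1} e^{2πi(mx + n x̄)/c}`. -/
noncomputable def kloostermanS (m n : ℤ) (c : ℕ) [NeZero c] : ℂ :=
  ∑ x : (ZMod c)ˣ,
    eModC c (m * (((x : ZMod c)).val : ℤ) + n * ((((x⁻¹ : (ZMod c)ˣ) : ZMod c)).val : ℤ))

/-- `T(a,b;c) = ∑_{x,y mod c} S(x², y²; c) e^{2πi(2xy + ax + by)/c}`. -/
noncomputable def TabcSum (a b : ℤ) (c : ℕ) [NeZero c] : ℂ :=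
  ∑ x ∈ Finset.range c, ∑ y ∈ Finset.range c,
    kloostermanS ((x : ℤ) ^ 2) ((y : ℤ) ^ 2) c *
      eModC c (2 * (x : ℤ) * (y : ℤ) + a * (x : ℤ) + b * (y : ℤ))

theorem eModC_eq_stdAddChar (c : ℕ) [NeZero c] (z : ℤ) :
    eModC c z = ZMod.stdAddChar (z : ZMod c) := by
  rw [eModC, ZMod.stdAddChar_coe]

theorem ZMod.sum_range_natCast {M : Type*} [AddCommMonoid M] (c : ℕ) [NeZero c] (g : ZMod c → M) :
    ∑ x ∈ Finset.range c, g (x : ZMod c) = ∑ x : ZMod c, g x := by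
  refine Finset.sum_bij' (fun x _ => (x : ZMod c)) (fun x _ => x.val) ?_ ?_ ?_ ?_ ?_
  · simp
  · intro x _
    exact Finset.mem_range.2 (ZMod.val_lt x)
  · intro x hx
    exact ZMod.val_cast_of_lt (Finset.mem_range.1 hx)
  · simp
  · simp

/-- Completing the square: `t x² + s y² + 2xy = t (x + s y)²` when `t s = 1`. -/
theorem sum_stdAddChar_complete_square (c : ℕ) [NeZero c] (a b : ZMod c) {t s : ZMod c}
    (hts : t * s = 1) :
    ∑ x : ZMod c, ∑ y : ZMod c,
        (ZMod.stdAddChar (x ^ 2 * t + y ^ 2 * s + (2 * x * y + a * x + b * y)) : ℂ) =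
      c * if b * t = a then ∑ x : ZMod c, ZMod.stdAddChar (t * x ^ 2 + a * x) else 0 := by
  have hshift (y : ZMod c) :
      ∑ x : ZMod c,
          (ZMod.stdAddChar (x ^ 2 * t + y ^ 2 * s + (2 * x * y + a * x + b * y)) : ℂ) =
        (∑ x : ZMod c, ZMod.stdAddChar (t * x ^ 2 + a * x)) *
          ZMod.stdAddChar (y * (b - a * s)) := by
    rw [Finset.sum_mul]
    refine Fintype.sum_equiv (Equiv.addRight (s * y)) _ _ fun x => ?_
    rw [← AddChar.map_add_eq_mul, Equiv.coe_addRight]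
    congr 1
    linear_combination (-(2 * x * y) - s * y ^ 2) * hts
  have hiff : b - a * s = 0 ↔ b * t = a :=
    ⟨fun h => by linear_combination t * h + a * hts,
      fun h => by linear_combination s * h - b * hts⟩
  rw [Finset.sum_comm, Finset.sum_congr rfl fun y _ => hshift y, ← Finset.mul_sum,
    AddChar.sum_mulShift _ (ZMod.isPrimitive_stdAddChar c), ZMod.card]
  simp only [hiff]
  split_ifs <;> simp [mul_comm]

/-- `T(a,b;c) = c ∑_{t mod c, (t,c)=1, bt ≡ a (mod c)} ∑_{x mod c} e^{2πi(tx² + ax)/c}`. -/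
theorem TabcSum_eq (c : ℕ) [NeZero c] (a b : ℤ) :
    TabcSum a b c =
      (c : ℂ) * ∑ t : (ZMod c)ˣ,
        (if (b : ZMod c) * (t : ZMod c) = (a : ZMod c) then
          ∑ x ∈ Finset.range c,
            eModC c ((((t : ZMod c)).val : ℤ) * (x : ℤ) ^ 2 + a * (x : ℤ))
        else 0) := by
  have hunit (t : (ZMod c)ˣ) : (t : ZMod c) * (t⁻¹ : (ZMod c)ˣ) = 1 := t.mul_inv
  have hx (t : ZMod c) := ZMod.sum_range_natCast c
    fun x : ZMod c => (ZMod.stdAddChar (t * x ^ 2 + (a : ZMod c) * x) : ℂ)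
  have hy (x : ZMod c) := ZMod.sum_range_natCast c fun y : ZMod c => ∑ t : (ZMod c)ˣ,
    (ZMod.stdAddChar (x ^ 2 * (t : ZMod c) + y ^ 2 * ((t⁻¹ : (ZMod c)ˣ) : ZMod c) +
      (2 * x * y + (a : ZMod c) * x + (b : ZMod c) * y)) : ℂ)
  have hxy := ZMod.sum_range_natCast c fun x : ZMod c => ∑ y : ZMod c, ∑ t : (ZMod c)ˣ,
    (ZMod.stdAddChar (x ^ 2 * (t : ZMod c) + y ^ 2 * ((t⁻¹ : (ZMod c)ˣ) : ZMod c) +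
      (2 * x * y + (a : ZMod c) * x + (b : ZMod c) * y)) : ℂ)
  simp only [TabcSum, kloostermanS, eModC_eq_stdAddChar, Finset.sum_mul, ← AddChar.map_add_eq_mul]
  push_cast
  simp only [ZMod.natCast_zmod_val, hx, hy, hxy]
  rw [Finset.mul_sum]
  simp only [← sum_stdAddChar_complete_square c _ _ (hunit _)]
  rw [Finset.sum_congr rfl fun x _ => Finset.sum_comm]
  exact Finset.sum_comm
end

section
/- Let c = c₁ c₂ be positive integers with c | c₁² and c₂ | c₁, let t, a be integers, and set Q(x) = t x² + a x and Q'(x) = 2 t x + a. Then ∑_{x=0}^{c-1} e^{2πi Q(x)/c} = c₂ · ∑_{x₁=0}^{c₁-1, Q'(x₁) ≡ 0 (mod c₂)} e^{2πi Q(x₁)/c}. -/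
open Complex Real BigOperators

/-- Split a sum over `range (m * n)` into residue classes modulo `m`. -/
theorem sum_range_mul_eq_sum_sum {M : Type*} [AddCommMonoid M] (f : ℕ → M) (m n : ℕ) :
    ∑ x ∈ Finset.range (m * n), f x =
      ∑ i ∈ Finset.range m, ∑ j ∈ Finset.range n, f (i + m * j) := by
  induction n with
  | zero => simp
  | succ n ih =>
    simp_rw [Finset.sum_range_succ, Finset.sum_add_distrib]
    rw [Nat.mul_succ, Finset.sum_range_add, ih]
    simp_rw [add_comm]

/-- Orthogonality of additive characters modulo `n`. -/
theorem sum_range_exp_two_pi_I_mul_div (n : ℕ) (hn : 0 < n) (m : ℤ) :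
    ∑ j ∈ Finset.range n, Complex.exp (2 * Real.pi * Complex.I * (m * (j : ℂ)) / (n : ℂ)) =
      if (n : ℤ) ∣ m then (n : ℂ) else 0 := by
  have hn' : (n : ℂ) ≠ 0 := by exact_mod_cast hn.ne'
  set ζ := Complex.exp (2 * Real.pi * Complex.I * m / n) with hζ
  have hpow (j : ℕ) :
      Complex.exp (2 * Real.pi * Complex.I * (m * (j : ℂ)) / (n : ℂ)) = ζ ^ j := by
    rw [hζ, ← Complex.exp_nat_mul]
    ring_nf
  have hζn : ζ ^ n = 1 := by
    rw [← hpow, Complex.exp_eq_one_iff]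
    exact ⟨m, by field_simp⟩
  have hone : ζ = 1 ↔ (n : ℤ) ∣ m := by
    rw [hζ, Complex.exp_eq_one_iff]
    constructor
    · rintro ⟨k, hk⟩
      refine ⟨k, ?_⟩
      have h2 := Complex.two_pi_I_ne_zero
      have : (m : ℂ) = n * k := by
        apply mul_left_cancel₀ h2
        rw [div_eq_iff hn'] at hk
        rw [hk]
        ring
      exact_mod_cast this
    · rintro ⟨k, rfl⟩
      exact ⟨k, by push_cast; field_simp⟩
  simp_rw [hpow]
  split_ifs with h
  · simp [hone.2 h]
  · have hne : ζ - 1 ≠ 0 := sub_ne_zero.2 fun h1 => h (hone.1 h1)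
    apply mul_right_cancel₀ hne
    rw [geom_sum_mul, hζn]
    simp

/-- for `c = c₁ c₂` with `c | c₁²`, `c₂ | c₁`, and `Q(x) = t x² + a x`,
`∑_{x mod c} e^{2πi Q(x)/c} = c₂ ∑_{x₁ mod c₁, Q'(x₁) ≡ 0 (mod c₂)} e^{2πi Q(x₁)/c}`. -/
theorem quadratic_sum_reduction (c₁ c₂ : ℕ) (h₁ : 0 < c₁) (h₂ : 0 < c₂)
    (hsq : c₁ * c₂ ∣ c₁ ^ 2) (hdvd : c₂ ∣ c₁) (t a : ℤ) :
    ∑ x ∈ Finset.range (c₁ * c₂),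
        Complex.exp (2 * Real.pi * Complex.I * (t * (x : ℂ) ^ 2 + a * (x : ℂ)) /
          ((c₁ : ℂ) * (c₂ : ℂ))) =
      (c₂ : ℂ) * ∑ x₁ ∈ (Finset.range c₁).filter fun x₁ : ℕ => (c₂ : ℤ) ∣ (2 * t * (x₁ : ℤ) + a),
        Complex.exp (2 * Real.pi * Complex.I * (t * (x₁ : ℂ) ^ 2 + a * (x₁ : ℂ)) /
          ((c₁ : ℂ) * (c₂ : ℂ))) := by
  have hc₁ : (c₁ : ℂ) ≠ 0 := by exact_mod_cast h₁.ne'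
  have hc₂ : (c₂ : ℂ) ≠ 0 := by exact_mod_cast h₂.ne'
  obtain ⟨k, hk⟩ := hsq
  have hk' : (c₁ : ℂ) ^ 2 = c₁ * c₂ * k := by exact_mod_cast hk
  have hterm (i j : ℕ) :
      Complex.exp (2 * Real.pi * Complex.I *
          (t * ((i + c₁ * j : ℕ) : ℂ) ^ 2 + a * ((i + c₁ * j : ℕ) : ℂ)) /
          ((c₁ : ℂ) * (c₂ : ℂ))) =
        Complex.exp (2 * Real.pi * Complex.I * (t * (i : ℂ) ^ 2 + a * (i : ℂ)) /
          ((c₁ : ℂ) * (c₂ : ℂ))) *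
        Complex.exp (2 * Real.pi * Complex.I * ((2 * t * (i : ℤ) + a : ℤ) * (j : ℂ)) /
          (c₂ : ℂ)) := by
    rw [← Complex.exp_add, Complex.exp_eq_exp_iff_exists_int]
    refine ⟨t * k * (j : ℤ) ^ 2, ?_⟩
    push_cast
    field_simp
    linear_combination (t : ℂ) * (j : ℂ) ^ 2 * hk'
  rw [sum_range_mul_eq_sum_sum, Finset.mul_sum, Finset.sum_filter]
  refine Finset.sum_congr rfl fun i _ => ?_
  simp_rw [hterm]
  rw [← Finset.mul_sum, sum_range_exp_two_pi_I_mul_div c₂ h₂]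
  split_ifs
  · ring
  · simp
end

section
/- Let k, ℓ be odd positive integers and let χ(n) = (n / kℓ) be the Jacobi symbol modulo kℓ. Let α, β ∈ ℂ with Re(α) > 1 and Re(β) > 1. Define Z_{k,ℓ}(α, β) as the sum over all tuples (r₁, r₂, g₁, g₂, q) of positive integers satisfying: r₁ and r₂ odd; g₁ | r₁²; g₂ | r₂² with gcd(r₂²/g₂, kℓ) = 1; q squarefree with gcd(q, 2r₂) = 1 and every prime factor of r₁ dividing q; of the term χ(q) · [∏_{p | r₂, p ∤ (r₂²/g₂)} (1 − 1/p)] · q^{−β} (r₁ r₂)^{−2β} (g₁ g₂)^{−α}. This sum converges absolutely, and Z_{k,ℓ}(α, β) = L(β, χ) · ζ(2α + 2β) · (1 − 2^{−2α−2β}) · D(α, β, χ) · (1 − χ(2)·2^{−β}) · ∏_{p | kℓ} (1 − p^{−1−2α−2β}) / (1 + p^{−α−2β} − p^{−1−2α−2β}), where L(β, χ) = ∑_{n ≥ 1} χ(n) n^{−β} and D(α, β, χ) = ∏_{p odd prime} (1 + p^{−α−2β}(1 − p^{−1−α} + χ(p) p^{−1−α−β})). -/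
open Complex BigOperators

/-- The sum `∑_{d e = n} h d e` of a function of two variables over the factorizations of `n`. -/
def factorizationSum (h : ℕ → ℕ → ℂ) (n : ℕ) : ℂ :=
  ∑ x ∈ n.divisorsAntidiagonal, h x.1 x.2

/-- Multiplicativity of a function of two positive integers. -/
structure IsBimultiplicative (h : ℕ → ℕ → ℂ) : Prop where
  map_one : h 1 1 = 1
  map_mul : ∀ {a b c d : ℕ}, Nat.Coprime (a * b) (c * d) → h (a * c) (b * d) = h a b * h c d

theorem factorizationSum_zero (h : ℕ → ℕ → ℂ) : factorizationSum h 0 = 0 := by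
  simp [factorizationSum]

theorem IsBimultiplicative.factorizationSum_one {h : ℕ → ℕ → ℂ} (hh : IsBimultiplicative h) :
    factorizationSum h 1 = 1 := by
  simp [factorizationSum, hh.map_one]

theorem IsBimultiplicative.factorizationSum_mul {h : ℕ → ℕ → ℂ} (hh : IsBimultiplicative h)
    {m n : ℕ} (cop : m.Coprime n) :
    factorizationSum h (m * n) = factorizationSum h m * factorizationSum h n := by
  simp only [factorizationSum]
  rw [Finset.sum_mul_sum, ← Finset.sum_product']
  symm
  apply Finset.sum_nbij' (fun x : (ℕ × ℕ) × ℕ × ℕ ↦ (x.1.1 * x.2.1, x.1.2 * x.2.2))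
    (fun y ↦ ((y.1.gcd m, y.2.gcd m), (y.1.gcd n, y.2.gcd n)))
  · rintro ⟨⟨a, b⟩, ⟨c, d⟩⟩ hx
    simp only [Finset.mem_product, Nat.mem_divisorsAntidiagonal] at hx ⊢
    obtain ⟨⟨rfl, ha⟩, ⟨rfl, hb⟩⟩ := hx
    exact ⟨by ring, mul_ne_zero ha hb⟩
  · rintro ⟨b1, b2⟩ hx
    simp only [Finset.mem_product, Nat.mem_divisorsAntidiagonal] at hx ⊢
    obtain ⟨hx, h0⟩ := hx
    rw [Nat.gcd_mul_gcd_of_coprime_of_mul_eq_mul cop hx,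
      Nat.gcd_mul_gcd_of_coprime_of_mul_eq_mul cop.symm (by rw [hx, mul_comm])]
    exact ⟨⟨rfl, left_ne_zero_of_mul h0⟩, rfl, right_ne_zero_of_mul h0⟩
  · rintro ⟨⟨a, b⟩, ⟨c, d⟩⟩ hx
    simp only [Finset.mem_product, Nat.mem_divisorsAntidiagonal] at hx ⊢
    obtain ⟨⟨rfl, ha⟩, ⟨rfl, hb⟩⟩ := hx
    have hac := cop.coprime_mul_right.coprime_mul_right_right
    have had := cop.coprime_mul_right.coprime_mul_left_right
    have hbc := cop.coprime_mul_left.coprime_mul_right_right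
    have hbd := cop.coprime_mul_left.coprime_mul_left_right
    simp only [Prod.mk.injEq]
    refine ⟨⟨?_, ?_⟩, ?_, ?_⟩
    · rw [Nat.gcd_mul_left, hbc.symm.gcd_eq_one, mul_one]
    · rw [mul_comm a, Nat.gcd_mul_left, had.symm.gcd_eq_one, mul_one]
    · rw [mul_comm a, Nat.gcd_mul_left, had.gcd_eq_one, mul_one]
    · rw [Nat.gcd_mul_right, hbc.gcd_eq_one, one_mul]
  · rintro ⟨b1, b2⟩ hx
    simp only [Nat.mem_divisorsAntidiagonal] at hx ⊢
    rw [← cop.gcd_mul _, ← cop.gcd_mul _, ← hx.1]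
    simp
  · rintro ⟨⟨a, b⟩, ⟨c, d⟩⟩ hx
    simp only [Finset.mem_product, Nat.mem_divisorsAntidiagonal] at hx ⊢
    obtain ⟨⟨rfl, ha⟩, ⟨rfl, hb⟩⟩ := hx
    exact (hh.map_mul cop).symm

theorem factorizationSum_eq_sum_divisors (h : ℕ → ℕ → ℂ) (n : ℕ) :
    factorizationSum h n = ∑ d ∈ n.divisors, h d (n / d) :=
  Nat.sum_divisorsAntidiagonal h

theorem factorizationSum_prime_pow (h : ℕ → ℕ → ℂ) {p : ℕ} (hp : p.Prime) (n : ℕ) :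
    factorizationSum h (p ^ n) = ∑ i ∈ Finset.range (n + 1), h (p ^ i) (p ^ (n - i)) := by
  rw [factorizationSum_eq_sum_divisors, Nat.sum_divisors_prime_pow hp]
  refine Finset.sum_congr rfl fun i hi ↦ ?_
  rw [Nat.pow_div (Nat.lt_succ_iff.mp (Finset.mem_range.mp hi)) hp.pos]

theorem HasSum.sum_fiberwise_finset {β γ : Type*} {f : β → ℂ} {a : ℂ} (hf : HasSum f a)
    (g : β → γ) (s : γ → Finset β) (hs : ∀ c, ∀ b ∈ s c, g b = c)
    (hfs : ∀ b, f b ≠ 0 → b ∈ s (g b)) : HasSum (fun c ↦ ∑ b ∈ s c, f b) a := by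
  have key : (fun c ↦ ∑ b ∈ s c, f b) = fun c ↦ ∑' b : g ⁻¹' {c}, f b := by
    funext c
    rw [tsum_subtype (g ⁻¹' ({c} : Set γ)) f, tsum_eq_sum (s := s c)]
    · exact Finset.sum_congr rfl fun b hb ↦ (Set.indicator_of_mem (by simpa using hs c b hb) f).symm
    · intro b hb
      by_contra hne
      obtain ⟨hbc, hfb⟩ := Set.indicator_apply_ne_zero.mp hne
      obtain rfl : g b = c := by simpa using hbc
      exact hb (hfs b hfb)
  rw [key]
  exact hf.tsum_fiberwise g

theorem HasSum.factorizationSum {h : ℕ → ℕ → ℂ} {a : ℂ}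
    (hf : HasSum (fun x : ℕ × ℕ ↦ h x.1 x.2) a) (h0 : ∀ m n, m * n = 0 → h m n = 0) :
    HasSum (factorizationSum h) a :=
  hf.sum_fiberwise_finset (fun x ↦ x.1 * x.2) Nat.divisorsAntidiagonal
    (fun _ _ hb ↦ (Nat.mem_divisorsAntidiagonal.mp hb).1)
    fun _ hb ↦ Nat.mem_divisorsAntidiagonal.mpr ⟨rfl, fun h' ↦ hb (h0 _ _ h')⟩

theorem isBimultiplicative_natCast_cpow (s : ℂ) :
    IsBimultiplicative fun g _ ↦ (g : ℂ) ^ s where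
  map_one := by simp
  map_mul _ := by push_cast; exact natCast_mul_natCast_cpow _ _ _

/-- The weight attached to a factorization `g * h = r₂ ^ 2` in `Z_{k,ℓ}`, where `N = kℓ`. -/
noncomputable def cofactorWeight (N : ℕ) (α : ℂ) (g h : ℕ) : ℂ :=
  if h.Coprime N then
    (∏ p ∈ (g * h).primeFactors.filter fun p ↦ ¬ p ∣ h, (1 - 1 / (p : ℂ))) * (g : ℂ) ^ (-α)
  else 0

theorem isBimultiplicative_cofactorWeight (N : ℕ) (α : ℂ) :
    IsBimultiplicative (cofactorWeight N α) where
  map_one := by simp [cofactorWeight]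
  map_mul {a b c d} hcop := by
    have hprod : (∏ p ∈ (a * c * (b * d)).primeFactors.filter fun p ↦ ¬ p ∣ b * d,
          (1 - 1 / (p : ℂ))) =
        (∏ p ∈ (a * b).primeFactors.filter fun p ↦ ¬ p ∣ b, (1 - 1 / (p : ℂ))) *
          ∏ p ∈ (c * d).primeFactors.filter fun p ↦ ¬ p ∣ d, (1 - 1 / (p : ℂ)) := by
      rw [mul_mul_mul_comm, hcop.primeFactors_mul, Finset.filter_union, Finset.prod_union]
      · congr 2
        · refine Finset.filter_congr fun p hp ↦ ?_
          have hpp := Nat.prime_of_mem_primeFactors hp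
          have : ¬ p ∣ d := fun h ↦ Nat.Prime.not_coprime_iff_dvd.mpr
            ⟨p, hpp, Nat.dvd_of_mem_primeFactors hp, h.mul_left c⟩ hcop
          rw [hpp.dvd_mul]
          tauto
        · refine Finset.filter_congr fun p hp ↦ ?_
          have hpp := Nat.prime_of_mem_primeFactors hp
          have : ¬ p ∣ b := fun h ↦ Nat.Prime.not_coprime_iff_dvd.mpr
            ⟨p, hpp, h.mul_left a, Nat.dvd_of_mem_primeFactors hp⟩ hcop
          rw [hpp.dvd_mul]
          tauto
      · exact Finset.disjoint_filter_filter hcop.disjoint_primeFactors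
    simp only [cofactorWeight, Nat.coprime_mul_iff_left, hprod]
    rw [ite_zero_mul_ite_zero]
    congr 1
    push_cast
    rw [natCast_mul_natCast_cpow]
    ring

/-- The part of the summand of `Z_{k,ℓ}` depending on `q` and `r₁`, summed over `g₁`. -/
noncomputable def linkedWeight (N : ℕ) (α β : ℂ) (q r : ℕ) : ℂ :=
  if Odd q ∧ Odd r ∧ Squarefree q ∧ ∀ p ∈ r.primeFactors, p ∣ q then
    ((jacobiSym (q : ℤ) N : ℤ) : ℂ) * (q : ℂ) ^ (-β) * (r : ℂ) ^ (-2 * β) *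
      factorizationSum (fun g _ ↦ (g : ℂ) ^ (-α)) (r ^ 2)
  else 0

theorem linkedWeight_eq_zero {N : ℕ} {α β : ℂ} {q r : ℕ} (h : q * r = 0) :
    linkedWeight N α β q r = 0 := by
  rcases mul_eq_zero.mp h with rfl | rfl <;> simp [linkedWeight]

theorem isBimultiplicative_linkedWeight (N : ℕ) (α β : ℂ) :
    IsBimultiplicative (linkedWeight N α β) where
  map_one := by
    simp [linkedWeight, (isBimultiplicative_natCast_cpow (-α)).factorizationSum_one]
  map_mul {a b c d} hcop := by
    have hac := hcop.coprime_mul_right.coprime_mul_right_right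
    have had := hcop.coprime_mul_right.coprime_mul_left_right
    have hbc := hcop.coprime_mul_left.coprime_mul_right_right
    have hbd := hcop.coprime_mul_left.coprime_mul_left_right
    have hcond : (Odd (a * c) ∧ Odd (b * d) ∧ Squarefree (a * c) ∧
          ∀ p ∈ (b * d).primeFactors, p ∣ a * c) ↔
        (Odd a ∧ Odd b ∧ Squarefree a ∧ ∀ p ∈ b.primeFactors, p ∣ a) ∧
          (Odd c ∧ Odd d ∧ Squarefree c ∧ ∀ p ∈ d.primeFactors, p ∣ c) := by
      have h1 : (∀ p ∈ b.primeFactors, p ∣ a * c) ↔ ∀ p ∈ b.primeFactors, p ∣ a :=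
        forall₂_congr fun p hp ↦
          (hbc.coprime_dvd_left (Nat.dvd_of_mem_primeFactors hp)).dvd_mul_right
      have h2 : (∀ p ∈ d.primeFactors, p ∣ a * c) ↔ ∀ p ∈ d.primeFactors, p ∣ c :=
        forall₂_congr fun p hp ↦
          (had.symm.coprime_dvd_left (Nat.dvd_of_mem_primeFactors hp)).dvd_mul_left
      rw [Nat.odd_mul, Nat.odd_mul, Nat.squarefree_mul hac, hbd.primeFactors_mul,
        Finset.forall_mem_union, h1, h2]
      tauto
    simp only [linkedWeight, hcond]
    rw [ite_zero_mul_ite_zero]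
    congr 1
    rw [mul_pow, (isBimultiplicative_natCast_cpow (-α)).factorizationSum_mul (hbd.pow 2 2)]
    push_cast
    rw [natCast_mul_natCast_cpow, natCast_mul_natCast_cpow, jacobiSym.mul_left]
    push_cast
    ring

/-- The part of the summand of `Z_{k,ℓ}` depending on `r₂`, summed over `g₂`. -/
noncomputable def freeWeight (N : ℕ) (α β : ℂ) (r : ℕ) : ℂ :=
  if Odd r then (r : ℂ) ^ (-2 * β) * factorizationSum (cofactorWeight N α) (r ^ 2) else 0

theorem freeWeight_one (N : ℕ) (α β : ℂ) : freeWeight N α β 1 = 1 := by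
  simp [freeWeight, (isBimultiplicative_cofactorWeight N α).factorizationSum_one]

theorem freeWeight_mul (N : ℕ) (α β : ℂ) {m n : ℕ} (h : m.Coprime n) :
    freeWeight N α β (m * n) = freeWeight N α β m * freeWeight N α β n := by
  simp only [freeWeight, Nat.odd_mul]
  rw [ite_zero_mul_ite_zero]
  congr 1
  rw [mul_pow, (isBimultiplicative_cofactorWeight N α).factorizationSum_mul (h.pow 2 2)]
  push_cast
  rw [natCast_mul_natCast_cpow]
  ring

/-- The product of the two parts of the summand of `Z_{k,ℓ}`, as a function of `u = q r₁`
and `r₂`. -/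
noncomputable def pairWeight (N : ℕ) (α β : ℂ) (u r : ℕ) : ℂ :=
  if u.Coprime r then factorizationSum (linkedWeight N α β) u * freeWeight N α β r else 0

theorem pairWeight_eq_zero {N : ℕ} {α β : ℂ} {u r : ℕ} (h : u * r = 0) :
    pairWeight N α β u r = 0 := by
  rcases mul_eq_zero.mp h with rfl | rfl <;> simp [pairWeight, freeWeight, factorizationSum_zero]

theorem isBimultiplicative_pairWeight (N : ℕ) (α β : ℂ) :
    IsBimultiplicative (pairWeight N α β) where
  map_one := by
    simp [pairWeight, freeWeight_one, (isBimultiplicative_linkedWeight N α β).factorizationSum_one]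
  map_mul {a b c d} hcop := by
    have hac := hcop.coprime_mul_right.coprime_mul_right_right
    have had := hcop.coprime_mul_right.coprime_mul_left_right
    have hbc := hcop.coprime_mul_left.coprime_mul_right_right
    have hbd := hcop.coprime_mul_left.coprime_mul_left_right
    have hcond : (a * c).Coprime (b * d) ↔ a.Coprime b ∧ c.Coprime d := by
      rw [Nat.coprime_mul_iff_left, Nat.coprime_mul_iff_right, Nat.coprime_mul_iff_right]
      have hcb := hbc.symm
      tauto
    simp only [pairWeight, hcond]
    rw [ite_zero_mul_ite_zero]
    congr 1
    rw [(isBimultiplicative_linkedWeight N α β).factorizationSum_mul hac, freeWeight_mul N α β hbd]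
    ring

/-- The summand of `Z_{k,ℓ}(α,β)`, where `N = kℓ`. -/
noncomputable def zSummand (N : ℕ) (α β : ℂ) (x : ℕ × ℕ × ℕ × ℕ × ℕ) : ℂ :=
  let r₁ := x.1
  let r₂ := x.2.1
  let g₁ := x.2.2.1
  let g₂ := x.2.2.2.1
  let q := x.2.2.2.2
  if Odd r₁ ∧ Odd r₂ ∧ g₁ ∣ r₁ ^ 2 ∧ g₂ ∣ r₂ ^ 2 ∧
      Nat.Coprime (r₂ ^ 2 / g₂) N ∧ Squarefree q ∧
      Nat.Coprime q (2 * r₂) ∧ (∀ p ∈ r₁.primeFactors, p ∣ q) then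
    ((jacobiSym (q : ℤ) N : ℤ) : ℂ) *
      (∏ p ∈ r₂.primeFactors.filter fun p => ¬ p ∣ (r₂ ^ 2 / g₂), (1 - 1 / (p : ℂ))) *
      (q : ℂ) ^ (-β) * ((r₁ * r₂ : ℕ) : ℂ) ^ (-2 * β) *
      ((g₁ * g₂ : ℕ) : ℂ) ^ (-α)
  else 0

theorem norm_jacobiSym_le_one (a : ℤ) (N : ℕ) : ‖((jacobiSym a N : ℤ) : ℂ)‖ ≤ 1 := by
  rcases jacobiSym.trichotomy a N with h | h | h <;> simp [h]

theorem norm_one_sub_one_div_le_one {p : ℕ} (hp : p.Prime) : ‖(1 - 1 / (p : ℂ))‖ ≤ 1 := by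
  have h : (1 - 1 / (p : ℂ)) = ((1 - 1 / (p : ℝ) : ℝ) : ℂ) := by push_cast; rfl
  have hp' : (1 : ℝ) ≤ p := by exact_mod_cast hp.one_le
  have h1 : 1 / (p : ℝ) ≤ 1 := by rw [div_le_one (by linarith)]; exact hp'
  have h2 : 0 ≤ 1 / (p : ℝ) := by positivity
  rw [h, Complex.norm_real, Real.norm_of_nonneg (by linarith)]
  linarith

theorem norm_zSummand_le (N : ℕ) (α β : ℂ) (x : ℕ × ℕ × ℕ × ℕ × ℕ) :
    ‖zSummand N α β x‖ ≤ (x.1 : ℝ) ^ (-2 * β.re) * ((x.2.1 : ℝ) ^ (-2 * β.re) *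
      ((x.2.2.1 : ℝ) ^ (-α.re) * ((x.2.2.2.1 : ℝ) ^ (-α.re) * (x.2.2.2.2 : ℝ) ^ (-β.re)))) := by
  obtain ⟨r₁, r₂, g₁, g₂, q⟩ := x
  simp only [zSummand]
  split_ifs with h
  · obtain ⟨h1, h2, hg1, hg2, -, hq, -, -⟩ := h
    have hr₁ := h1.pos
    have hr₂ := h2.pos
    have hg₁ := Nat.pos_of_dvd_of_pos hg1 (pow_pos hr₁ 2)
    have hg₂ := Nat.pos_of_dvd_of_pos hg2 (pow_pos hr₂ 2)
    have hq₀ := Nat.pos_of_ne_zero hq.ne_zero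
    have hre : (-2 * β).re = -2 * β.re := by simp
    push_cast
    rw [natCast_mul_natCast_cpow, natCast_mul_natCast_cpow]
    simp only [norm_mul, norm_natCast_cpow_of_pos hr₁, norm_natCast_cpow_of_pos hr₂,
      norm_natCast_cpow_of_pos hg₁, norm_natCast_cpow_of_pos hg₂, norm_natCast_cpow_of_pos hq₀,
      hre, neg_re]
    have hprod : ‖∏ p ∈ r₂.primeFactors.filter fun p => ¬ p ∣ (r₂ ^ 2 / g₂),
        (1 - 1 / (p : ℂ))‖ ≤ 1 := by
      rw [norm_prod]
      exact Finset.prod_le_one (fun _ _ ↦ norm_nonneg _) fun p hp ↦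
        norm_one_sub_one_div_le_one (Nat.prime_of_mem_primeFactors (Finset.mem_filter.mp hp).1)
    have hle := mul_le_one₀ (norm_jacobiSym_le_one q N) (norm_nonneg _) hprod
    calc _ = _ * ((r₁ : ℝ) ^ (-2 * β.re) * ((r₂ : ℝ) ^ (-2 * β.re) *
          ((g₁ : ℝ) ^ (-α.re) * ((g₂ : ℝ) ^ (-α.re) * (q : ℝ) ^ (-β.re))))) := by ring
      _ ≤ _ := mul_le_of_le_one_left (by positivity) hle
  · rw [norm_zero]
    positivity

theorem summable_zSummand (N : ℕ) {α β : ℂ} (hα : 1 < α.re) (hβ : 1 < β.re) :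
    Summable (zSummand N α β) := by
  have h1 : Summable fun n : ℕ ↦ (n : ℝ) ^ (-α.re) := Real.summable_nat_rpow.mpr (by linarith)
  have h2 : Summable fun n : ℕ ↦ (n : ℝ) ^ (-β.re) := Real.summable_nat_rpow.mpr (by linarith)
  have h3 : Summable fun n : ℕ ↦ (n : ℝ) ^ (-2 * β.re) :=
    Real.summable_nat_rpow.mpr (by linarith)
  refine Summable.of_norm_bounded ?_ (norm_zSummand_le N α β)
  refine h3.mul_of_nonneg (h3.mul_of_nonneg (h1.mul_of_nonneg (h1.mul_of_nonneg h2 ?_ ?_)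
    ?_ ?_) ?_ ?_) ?_ ?_
  all_goals exact fun _ ↦ by simp only [Pi.zero_apply]; positivity

theorem sum_zSummand_eq (N : ℕ) (α β : ℂ) (q r₁ r₂ : ℕ) :
    ∑ g₁ ∈ (r₁ ^ 2).divisors, ∑ g₂ ∈ (r₂ ^ 2).divisors, zSummand N α β (r₁, r₂, g₁, g₂, q) =
      if (q * r₁).Coprime r₂ then linkedWeight N α β q r₁ * freeWeight N α β r₂ else 0 := by
  by_cases hP : Odd q ∧ Odd r₁ ∧ Squarefree q ∧ ∀ p ∈ r₁.primeFactors, p ∣ q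
  swap
  · have hz : linkedWeight N α β q r₁ = 0 := if_neg hP
    rw [hz, zero_mul, ite_self]
    refine Finset.sum_eq_zero fun g₁ _ ↦ Finset.sum_eq_zero fun g₂ _ ↦ if_neg ?_
    rintro ⟨h1, -, -, -, -, hq, hqr, h2⟩
    exact hP ⟨Nat.coprime_two_right.mp hqr.coprime_mul_right_right, h1, hq, h2⟩
  by_cases hr : Odd r₂
  swap
  · have hz : freeWeight N α β r₂ = 0 := if_neg hr
    rw [hz, mul_zero, ite_self]
    exact Finset.sum_eq_zero fun g₁ _ ↦ Finset.sum_eq_zero fun g₂ _ ↦ if_neg fun h ↦ hr h.2.1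
  by_cases hc : (q * r₁).Coprime r₂
  swap
  · rw [if_neg hc]
    refine Finset.sum_eq_zero fun g₁ _ ↦ Finset.sum_eq_zero fun g₂ _ ↦ if_neg fun h ↦ hc ?_
    have hqr := h.2.2.2.2.2.2.1.coprime_mul_left_right
    refine Nat.Coprime.mul_left hqr (Nat.Coprime.symm ?_)
    refine Nat.coprime_of_dvd fun p hp hp2 hp1 ↦ ?_
    exact Nat.Prime.not_coprime_iff_dvd.mpr
      ⟨p, hp, hP.2.2.2 p (hp.mem_primeFactors hp1 hP.2.1.pos.ne'), hp2⟩ hqr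
  rw [if_pos hc, linkedWeight, if_pos hP, freeWeight, if_pos hr, factorizationSum_eq_sum_divisors,
    factorizationSum_eq_sum_divisors]
  rw [mul_mul_mul_comm, Finset.sum_mul_sum, Finset.mul_sum]
  refine Finset.sum_congr rfl fun g₁ hg₁ ↦ ?_
  rw [Finset.mul_sum]
  refine Finset.sum_congr rfl fun g₂ hg₂ ↦ ?_
  have hd₁ := Nat.dvd_of_mem_divisors hg₁
  have hd₂ := Nat.dvd_of_mem_divisors hg₂
  have hq2 : q.Coprime (2 * r₂) :=
    Nat.Coprime.mul_right (Nat.coprime_two_right.mpr hP.1) hc.coprime_mul_right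
  simp only [zSummand, cofactorWeight, Nat.mul_div_cancel' hd₂,
    Nat.primeFactors_pow r₂ two_ne_zero]
  by_cases hN : (r₂ ^ 2 / g₂).Coprime N
  · rw [if_pos ⟨hP.2.1, hr, hd₁, hd₂, hN, hP.2.2.1, hq2, hP.2.2.2⟩, if_pos hN]
    push_cast
    rw [natCast_mul_natCast_cpow, natCast_mul_natCast_cpow]
    ring
  · rw [if_neg fun h ↦ hN h.2.2.2.2.1, if_neg hN, mul_zero, mul_zero]

/-- Regroups the variables `(r₁, r₂, g₁, g₂, q)` as `(((q, r₁), r₂), (g₁, g₂))`. -/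
def regroupVariables :
    ((ℕ × ℕ) × ℕ) × ℕ × ℕ ≃ ℕ × ℕ × ℕ × ℕ × ℕ where
  toFun y := (y.1.1.2, y.1.2, y.2.1, y.2.2, y.1.1.1)
  invFun x := (((x.2.2.2.2, x.1), x.2.1), (x.2.2.1, x.2.2.2.1))

theorem hasSum_factorizationSum_pairWeight {N : ℕ} {α β a : ℂ} (h : HasSum (zSummand N α β) a) :
    HasSum (factorizationSum (pairWeight N α β)) a := by
  have h1 := (regroupVariables.hasSum_iff.mpr h).sum_fiberwise_finset Prod.fst
    (fun c ↦ {c} ×ˢ ((c.1.2 ^ 2).divisors ×ˢ (c.2 ^ 2).divisors))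
    (fun c b hb ↦ Finset.mem_singleton.mp (Finset.mem_product.mp hb).1) (by
      rintro ⟨⟨⟨q, r₁⟩, r₂⟩, g₁, g₂⟩ hne
      have hcond := (ite_ne_right_iff.mp hne).1
      simp only [Finset.mem_product, Finset.mem_singleton, Nat.mem_divisors, true_and]
      exact ⟨⟨hcond.2.2.1, (pow_pos hcond.1.pos 2).ne'⟩,
        hcond.2.2.2.1, (pow_pos hcond.2.1.pos 2).ne'⟩)
  have h2 : HasSum (fun c : (ℕ × ℕ) × ℕ ↦ if (c.1.1 * c.1.2).Coprime c.2 then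
      linkedWeight N α β c.1.1 c.1.2 * freeWeight N α β c.2 else 0) a := by
    convert h1 using 2 with c
    rw [Finset.sum_product, Finset.sum_singleton, Finset.sum_product, ← sum_zSummand_eq]
    rfl
  have h3 := h2.sum_fiberwise_finset (fun c ↦ (c.1.1 * c.1.2, c.2))
    (fun y ↦ y.1.divisorsAntidiagonal ×ˢ {y.2}) (by
      rintro ⟨u, r⟩ ⟨⟨q, r₁⟩, r₂⟩ hb
      simp only [Finset.mem_product, Finset.mem_singleton, Nat.mem_divisorsAntidiagonal] at hb
      rw [hb.1.1, hb.2]) (by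
      rintro ⟨⟨q, r₁⟩, r₂⟩ hne
      simp only [Finset.mem_product, Finset.mem_singleton, Nat.mem_divisorsAntidiagonal, true_and,
        and_true]
      intro h0
      simp [linkedWeight_eq_zero h0] at hne)
  refine HasSum.factorizationSum ?_ fun m n ↦ pairWeight_eq_zero
  convert h3 using 2 with y
  rw [Finset.sum_product]
  simp only [Finset.sum_singleton]
  rw [pairWeight, factorizationSum, Finset.sum_mul]
  split_ifs with hy
  · refine Finset.sum_congr rfl fun x hx ↦ ?_
    rw [(Nat.mem_divisorsAntidiagonal.mp hx).1, if_pos hy]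
  · refine (Finset.sum_eq_zero fun x hx ↦ ?_).symm
    rw [(Nat.mem_divisorsAntidiagonal.mp hx).1, if_neg hy]

theorem natCast_pow_cpow (n i : ℕ) (s : ℂ) : ((n ^ i : ℕ) : ℂ) ^ s = ((n : ℂ) ^ s) ^ i := by
  induction i with
  | zero => simp
  | succ i ih => rw [pow_succ, Nat.cast_mul, natCast_mul_natCast_cpow, ih, pow_succ]

theorem natCast_cpow_neg_two_mul (n : ℕ) (s : ℂ) :
    (n : ℂ) ^ (-2 * s) = ((n : ℂ) ^ (-s)) ^ 2 := by
  rw [← cpow_nat_mul]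
  congr 1
  push_cast
  ring

theorem factorizationSum_natCast_cpow_prime_pow (s : ℂ) {p : ℕ} (hp : p.Prime) (n : ℕ) :
    factorizationSum (fun g _ ↦ (g : ℂ) ^ s) (p ^ n) =
      ∑ i ∈ Finset.range (n + 1), ((p : ℂ) ^ s) ^ i := by
  rw [factorizationSum_prime_pow _ hp]
  exact Finset.sum_congr rfl fun i _ ↦ natCast_pow_cpow p i s

theorem factorizationSum_linkedWeight_prime_pow (N : ℕ) (α β : ℂ) {p : ℕ} (hp : p.Prime)
    (hodd : Odd p) (e : ℕ) :
    factorizationSum (linkedWeight N α β) (p ^ (e + 1)) =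
      ((jacobiSym (p : ℤ) N : ℤ) : ℂ) * (p : ℂ) ^ (-β) * (((p : ℂ) ^ (-β)) ^ 2) ^ e *
        ∑ i ∈ Finset.range (2 * e + 1), ((p : ℂ) ^ (-α)) ^ i := by
  rw [factorizationSum_prime_pow _ hp, Finset.sum_eq_single 1]
  · have hcond : Odd (p ^ 1) ∧ Odd (p ^ e) ∧ Squarefree (p ^ 1) ∧
        ∀ l ∈ (p ^ e).primeFactors, l ∣ p ^ 1 := by
      refine ⟨hodd.pow, hodd.pow, ?_, fun l hl ↦ ?_⟩
      · rw [pow_one]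
        exact hp.prime.squarefree
      · rw [pow_one]
        exact (Nat.prime_of_mem_primeFactors hl).dvd_of_dvd_pow (Nat.dvd_of_mem_primeFactors hl)
    rw [Nat.add_sub_cancel, linkedWeight, if_pos hcond, ← pow_mul, mul_comm e 2,
      factorizationSum_natCast_cpow_prime_pow _ hp, natCast_pow_cpow,
      natCast_pow_cpow, natCast_cpow_neg_two_mul, pow_one, pow_one]
  · intro i hi hne
    refine if_neg fun h ↦ ?_
    obtain rfl | hi2 : i = 0 ∨ 2 ≤ i := by omega
    · have := h.2.2.2 p (hp.mem_primeFactors (dvd_pow_self p (by omega)) (pow_ne_zero _ hp.ne_zero))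
      exact hp.one_lt.ne' (Nat.dvd_one.mp (by simpa using this))
    · have := Nat.isUnit_iff.mp (h.2.2.1 p ((sq p).symm ▸ pow_dvd_pow p hi2))
      exact hp.one_lt.ne' this
  · simp

theorem factorizationSum_linkedWeight_two_pow (N : ℕ) (α β : ℂ) (e : ℕ) :
    factorizationSum (linkedWeight N α β) (2 ^ (e + 1)) = 0 := by
  rw [factorizationSum_prime_pow _ Nat.prime_two]
  refine Finset.sum_eq_zero fun i _ ↦ if_neg fun h ↦ ?_
  have h1 := h.1.mul h.2.1
  rw [← pow_add] at h1
  rw [Nat.odd_pow_iff (by omega)] at h1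
  exact absurd h1 (by decide)

theorem factorizationSum_cofactorWeight_prime_pow (N : ℕ) (α : ℂ) {p : ℕ} (hp : p.Prime)
    {n : ℕ} (hn : n ≠ 0) :
    factorizationSum (cofactorWeight N α) (p ^ n) =
      (if p.Coprime N then ∑ i ∈ Finset.range n, ((p : ℂ) ^ (-α)) ^ i else 0) +
        (1 - 1 / (p : ℂ)) * ((p : ℂ) ^ (-α)) ^ n := by
  rw [factorizationSum_prime_pow _ hp, Finset.sum_range_succ]
  congr 1
  · rw [Finset.ite_sum_zero]
    refine Finset.sum_congr rfl fun i hi ↦ ?_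
    have hi' : i < n := Finset.mem_range.mp hi
    simp only [cofactorWeight, Nat.coprime_pow_left_iff (Nat.sub_pos_of_lt hi')]
    rw [← pow_add,
      Nat.add_sub_cancel' hi'.le, Nat.primeFactors_prime_pow hn hp, Finset.filter_singleton,
      if_neg (not_not.mpr (dvd_pow_self p (by omega))), Finset.prod_empty, one_mul,
      natCast_pow_cpow]
  · rw [cofactorWeight, Nat.sub_self, pow_zero, if_pos (Nat.coprime_one_left N), mul_one,
      Nat.primeFactors_prime_pow hn hp, Finset.filter_singleton, if_pos hp.not_dvd_one,
      Finset.prod_singleton, natCast_pow_cpow]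

theorem freeWeight_prime_pow (N : ℕ) (α β : ℂ) {p : ℕ} (hp : p.Prime) (hodd : Odd p) (e : ℕ) :
    freeWeight N α β (p ^ (e + 1)) =
      (((p : ℂ) ^ (-β)) ^ 2) ^ (e + 1) *
        ((if p.Coprime N then ∑ i ∈ Finset.range (2 * (e + 1)), ((p : ℂ) ^ (-α)) ^ i else 0) +
          (1 - 1 / (p : ℂ)) * ((p : ℂ) ^ (-α)) ^ (2 * (e + 1))) := by
  rw [freeWeight, if_pos hodd.pow, ← pow_mul, mul_comm (e + 1) 2,
    factorizationSum_cofactorWeight_prime_pow N α hp (by omega), natCast_pow_cpow,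
    natCast_cpow_neg_two_mul]

theorem factorizationSum_pairWeight_prime_pow (N : ℕ) (α β : ℂ) {p : ℕ} (hp : p.Prime) (e : ℕ) :
    factorizationSum (pairWeight N α β) (p ^ (e + 1)) =
      factorizationSum (linkedWeight N α β) (p ^ (e + 1)) + freeWeight N α β (p ^ (e + 1)) := by
  have h1 : factorizationSum (linkedWeight N α β) 1 = 1 :=
    (isBimultiplicative_linkedWeight N α β).factorizationSum_one
  rw [factorizationSum_prime_pow _ hp, Finset.sum_range_succ, Finset.sum_range_succ',
    Finset.sum_eq_zero, zero_add, add_comm]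
  · simp [pairWeight, h1, freeWeight_one]
  · intro i hi
    have hi' : i < e := Finset.mem_range.mp hi
    refine if_neg fun h ↦ ?_
    rw [Nat.coprime_pow_left_iff (by omega), Nat.coprime_pow_right_iff (by omega),
      Nat.coprime_self] at h
    exact hp.one_lt.ne' h

theorem one_sub_ne_zero_of_norm_lt_one {z : ℂ} (hz : ‖z‖ < 1) : 1 - z ≠ 0 := by
  intro h
  rw [← sub_eq_zero.mp h, norm_one] at hz
  exact lt_irrefl _ hz

theorem norm_sq_lt_one {z : ℂ} (hz : ‖z‖ < 1) : ‖z ^ 2‖ < 1 := by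
  rw [norm_pow]
  exact pow_lt_one₀ (norm_nonneg _) hz two_ne_zero

theorem norm_mul_lt_one {z w : ℂ} (hz : ‖z‖ < 1) (hw : ‖w‖ < 1) : ‖z * w‖ < 1 := by
  rw [norm_mul]
  exact mul_lt_one_of_nonneg_of_lt_one_left (norm_nonneg _) hz hw.le

theorem hasSum_sq_pow_mul_geom_sum_odd {x y : ℂ} (hx : ‖x‖ < 1) (hy : ‖y‖ < 1) :
    HasSum (fun e : ℕ ↦ (x ^ 2) ^ e * ∑ i ∈ Finset.range (2 * e + 1), y ^ i)
      ((1 + x ^ 2 * y) / ((1 - x ^ 2) * (1 - x ^ 2 * y ^ 2))) := by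
  have hx2 := norm_sq_lt_one hx
  have hxy := norm_mul_lt_one hx2 (norm_sq_lt_one hy)
  have h1 := one_sub_ne_zero_of_norm_lt_one hx2
  have h2 := one_sub_ne_zero_of_norm_lt_one hxy
  have h3 := one_sub_ne_zero_of_norm_lt_one hy
  have hval : (1 + x ^ 2 * y) / ((1 - x ^ 2) * (1 - x ^ 2 * y ^ 2)) =
      ((1 - x ^ 2)⁻¹ - y * (1 - x ^ 2 * y ^ 2)⁻¹) / (1 - y) := by
    field_simp
    ring
  rw [hval]
  refine HasSum.congr_fun (((hasSum_geometric_of_norm_lt_one hx2).sub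
    ((hasSum_geometric_of_norm_lt_one hxy).mul_left y)).div_const (1 - y)) fun e ↦ ?_
  rw [geom_sum_eq (sub_ne_zero.mp h3).symm, ← neg_sub 1 y, ← neg_sub 1 (y ^ _), neg_div_neg_eq,
    pow_succ y, pow_mul, mul_pow]
  ring

theorem hasSum_sq_pow_mul_geom_sum_even {x y : ℂ} (hx : ‖x‖ < 1) (hy : ‖y‖ < 1) :
    HasSum (fun e : ℕ ↦ (x ^ 2) ^ (e + 1) * ∑ i ∈ Finset.range (2 * (e + 1)), y ^ i)
      (x ^ 2 * (1 + y) / ((1 - x ^ 2) * (1 - x ^ 2 * y ^ 2))) := by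
  have hx2 := norm_sq_lt_one hx
  have hxy := norm_mul_lt_one hx2 (norm_sq_lt_one hy)
  have h1 := one_sub_ne_zero_of_norm_lt_one hx2
  have h2 := one_sub_ne_zero_of_norm_lt_one hxy
  have h3 := one_sub_ne_zero_of_norm_lt_one hy
  have hval : x ^ 2 * (1 + y) / ((1 - x ^ 2) * (1 - x ^ 2 * y ^ 2)) =
      (x ^ 2 * (1 - x ^ 2)⁻¹ - x ^ 2 * y ^ 2 * (1 - x ^ 2 * y ^ 2)⁻¹) / (1 - y) := by
    field_simp
    ring
  rw [hval]
  refine HasSum.congr_fun ((((hasSum_geometric_of_norm_lt_one hx2).mul_left (x ^ 2)).sub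
    ((hasSum_geometric_of_norm_lt_one hxy).mul_left (x ^ 2 * y ^ 2))).div_const (1 - y)) fun e ↦ ?_
  rw [geom_sum_eq (sub_ne_zero.mp h3).symm, ← neg_sub 1 y, ← neg_sub 1 (y ^ _), neg_div_neg_eq,
    pow_mul, mul_pow]
  ring

theorem hasSum_factorizationSum_pairWeight_prime_pow (N : ℕ) {α β : ℂ} (hα : 1 < α.re)
    (hβ : 1 < β.re) {p : ℕ} (hp : p.Prime) (hodd : Odd p) {x y c : ℂ} (hx : (p : ℂ) ^ (-β) = x)
    (hy : (p : ℂ) ^ (-α) = y) (hc : ((jacobiSym (p : ℤ) N : ℤ) : ℂ) = c) :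
    HasSum (fun e ↦ factorizationSum (pairWeight N α β) (p ^ e))
      (1 + (c * x * ((1 + x ^ 2 * y) / ((1 - x ^ 2) * (1 - x ^ 2 * y ^ 2))) +
        ((if p.Coprime N then x ^ 2 * (1 + y) / ((1 - x ^ 2) * (1 - x ^ 2 * y ^ 2)) else 0) +
          (1 - 1 / (p : ℂ)) * (x ^ 2 * y ^ 2) * (1 - x ^ 2 * y ^ 2)⁻¹))) := by
  have hnorm {s : ℂ} (hs : 1 < s.re) : ‖(p : ℂ) ^ (-s)‖ < 1 := by
    rw [norm_natCast_cpow_of_pos hp.pos, neg_re]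
    exact Real.rpow_lt_one_of_one_lt_of_neg (by exact_mod_cast hp.one_lt) (by linarith)
  have hx1 : ‖x‖ < 1 := hx ▸ hnorm hβ
  have hy1 : ‖y‖ < 1 := hy ▸ hnorm hα
  have hxy := norm_mul_lt_one (norm_sq_lt_one hx1) (norm_sq_lt_one hy1)
  rw [← hasSum_nat_add_iff' 1, Finset.sum_range_one, pow_zero,
    (isBimultiplicative_pairWeight N α β).factorizationSum_one, add_sub_cancel_left]
  have hmid : HasSum (fun e : ℕ ↦ if p.Coprime N then
      (x ^ 2) ^ (e + 1) * ∑ i ∈ Finset.range (2 * (e + 1)), y ^ i else 0)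
      (if p.Coprime N then x ^ 2 * (1 + y) / ((1 - x ^ 2) * (1 - x ^ 2 * y ^ 2)) else 0) := by
    split_ifs
    · exact hasSum_sq_pow_mul_geom_sum_even hx1 hy1
    · exact hasSum_zero
  refine HasSum.congr_fun (((hasSum_sq_pow_mul_geom_sum_odd hx1 hy1).mul_left (c * x)).add
      (hmid.add ((hasSum_geometric_of_norm_lt_one hxy).mul_left
        ((1 - 1 / (p : ℂ)) * (x ^ 2 * y ^ 2))))) fun e ↦ ?_
  rw [factorizationSum_pairWeight_prime_pow N α β hp,
    factorizationSum_linkedWeight_prime_pow N α β hp hodd, freeWeight_prime_pow N α β hp hodd,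
    hx, hy, hc]
  split_ifs <;> ring

theorem factorizationSum_pairWeight_two_pow (N : ℕ) (α β : ℂ) (e : ℕ) :
    factorizationSum (pairWeight N α β) (2 ^ e) = if e = 0 then 1 else 0 := by
  cases e with
  | zero => simp [(isBimultiplicative_pairWeight N α β).factorizationSum_one]
  | succ e =>
    rw [factorizationSum_pairWeight_prime_pow N α β Nat.prime_two,
      factorizationSum_linkedWeight_two_pow, freeWeight, if_neg, if_neg e.succ_ne_zero, zero_add]
    rw [Nat.odd_pow_iff e.succ_ne_zero]
    decide

/-- The Euler factor at `p` of `D(α,β,χ)`, where `χ = (· / N)`. -/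
noncomputable def dFactor (N : ℕ) (α β : ℂ) (p : ℕ) : ℂ :=
  1 + (p : ℂ) ^ (-α - 2 * β) * (1 - (p : ℂ) ^ (-1 - α) +
    ((jacobiSym (p : ℤ) N : ℤ) : ℂ) * (p : ℂ) ^ (-1 - α - β))

/-- The correction of the Euler factor of `Z_{k,ℓ}` at a prime `p` dividing `kℓ`. -/
noncomputable def ramifiedFactor (α β : ℂ) (p : ℕ) : ℂ :=
  (1 - (p : ℂ) ^ (-1 - 2 * α - 2 * β)) /
    (1 + (p : ℂ) ^ (-α - 2 * β) - (p : ℂ) ^ (-1 - 2 * α - 2 * β))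

theorem tsum_factorizationSum_pairWeight_prime_pow {N : ℕ} (hN : N ≠ 0) {α β : ℂ}
    (hα : 1 < α.re) (hβ : 1 < β.re) {p : ℕ} (hp : p.Prime) (hodd : Odd p) :
    ∑' e, factorizationSum (pairWeight N α β) (p ^ e) =
      (1 - ((jacobiSym (p : ℤ) N : ℤ) : ℂ) * (p : ℂ) ^ (-β))⁻¹ *
        (1 - (p : ℂ) ^ (-(2 * α + 2 * β)))⁻¹ * dFactor N α β p *
        if p ∣ N then ramifiedFactor α β p else 1 := by
  have hp0 : (p : ℂ) ≠ 0 := Nat.cast_ne_zero.mpr hp.ne_zero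
  have hnorm {s : ℂ} (hs : 1 < s.re) : ‖(p : ℂ) ^ (-s)‖ < 1 := by
    rw [norm_natCast_cpow_of_pos hp.pos, neg_re]
    exact Real.rpow_lt_one_of_one_lt_of_neg (by exact_mod_cast hp.one_lt) (by linarith)
  obtain ⟨x, hx⟩ : ∃ x, (p : ℂ) ^ (-β) = x := ⟨_, rfl⟩
  obtain ⟨y, hy⟩ : ∃ y, (p : ℂ) ^ (-α) = y := ⟨_, rfl⟩
  have hx1 : ‖x‖ < 1 := hx ▸ hnorm hβ
  have hy1 : ‖y‖ < 1 := hy ▸ hnorm hα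
  rw [(hasSum_factorizationSum_pairWeight_prime_pow N hα hβ hp hodd hx hy rfl).tsum_eq]
  have hw : (p : ℂ) ^ (-1 : ℂ) = 1 / (p : ℂ) := by rw [cpow_neg_one, one_div]
  have e1 : (p : ℂ) ^ (-(2 * α + 2 * β)) = x ^ 2 * y ^ 2 := by
    rw [← hx, ← hy, show -(2 * α + 2 * β) = -β + -β + (-α + -α) by ring]
    simp only [cpow_add _ _ hp0]
    ring
  have e2 : (p : ℂ) ^ (-α - 2 * β) = x ^ 2 * y := by
    rw [← hx, ← hy, show -α - 2 * β = -β + -β + -α by ring]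
    simp only [cpow_add _ _ hp0]
    ring
  have e3 : (p : ℂ) ^ (-1 - α) = 1 / (p : ℂ) * y := by
    rw [← hy, ← hw, sub_eq_add_neg, cpow_add _ _ hp0]
  have e4 : (p : ℂ) ^ (-1 - α - β) = 1 / (p : ℂ) * y * x := by
    rw [← e3, ← hx, sub_eq_add_neg, cpow_add _ _ hp0]
  have e5 : (p : ℂ) ^ (-1 - 2 * α - 2 * β) = 1 / (p : ℂ) * (x ^ 2 * y ^ 2) := by
    rw [← e1, ← hw, ← cpow_add _ _ hp0]
    congr 1
    ring
  have hx2 := norm_sq_lt_one hx1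
  have hxy := norm_mul_lt_one hx2 (norm_sq_lt_one hy1)
  have h1 := one_sub_ne_zero_of_norm_lt_one hx2
  have h2 := one_sub_ne_zero_of_norm_lt_one hxy
  rw [dFactor, ramifiedFactor, e1, e2, e3, e4, e5, hx]
  by_cases hpN : p ∣ N
  · have hcop : ¬ p.Coprime N := fun h ↦ hp.coprime_iff_not_dvd.mp h hpN
    have hj : jacobiSym (p : ℤ) N = 0 := jacobiSym.eq_zero_iff.mpr ⟨hN, hcop⟩
    rw [hj, if_neg hcop, if_pos hpN]
    have hd : 1 + x ^ 2 * y - 1 / (p : ℂ) * (x ^ 2 * y ^ 2) ≠ 0 := by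
      have hx_half : ‖x‖ ≤ 1 / 2 := by
        rw [← hx, norm_natCast_cpow_of_pos hp.pos, neg_re]
        have hp2 : (2 : ℝ) ≤ p := by exact_mod_cast hp.two_le
        calc (p : ℝ) ^ (-β.re) ≤ (p : ℝ) ^ (-1 : ℝ) :=
              Real.rpow_le_rpow_of_exponent_le (by linarith) (by linarith)
          _ = 1 / p := by rw [Real.rpow_neg_one, one_div]
          _ ≤ 1 / 2 := by gcongr
      have hw1 : ‖1 / (p : ℂ)‖ ≤ 1 := by
        rw [norm_div, norm_one, norm_natCast]
        exact div_le_self zero_le_one (by exact_mod_cast hp.one_le)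
      have hwy : ‖1 - 1 / (p : ℂ) * y‖ ≤ 2 := by
        refine (norm_sub_le _ _).trans ?_
        rw [norm_one, norm_mul]
        linarith [mul_le_one₀ hw1 (norm_nonneg y) hy1.le]
      have hz : ‖-(x ^ 2 * y * (1 - 1 / (p : ℂ) * y))‖ < 1 := by
        rw [norm_neg, norm_mul, norm_mul, norm_pow]
        calc ‖x‖ ^ 2 * ‖y‖ * ‖1 - 1 / (p : ℂ) * y‖ ≤ (1 / 2) ^ 2 * 1 * 2 := by gcongr
          _ < 1 := by norm_num
      convert one_sub_ne_zero_of_norm_lt_one hz using 1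
      ring
    rw [eq_comm]
    push_cast
    rw [show 1 + x ^ 2 * y * (1 - 1 / (p : ℂ) * y + 0 * (1 / (p : ℂ) * y * x)) =
      1 + x ^ 2 * y - 1 / (p : ℂ) * (x ^ 2 * y ^ 2) by ring]
    rw [mul_assoc, mul_div_cancel₀ _ hd]
    field_simp
    ring
  · have hcop := hp.coprime_iff_not_dvd.mpr hpN
    rw [if_pos hcop, if_neg hpN]
    have hm := one_sub_ne_zero_of_norm_lt_one hx1
    have hm' := one_sub_ne_zero_of_norm_lt_one (z := -x) (by rwa [norm_neg])
    rw [sub_neg_eq_add] at hm'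
    have hfac : 1 - x ^ 2 = (1 - x) * (1 + x) := by ring
    rw [hfac]
    rcases jacobiSym.eq_one_or_neg_one (a := p) (b := N) hcop with h | h
    · rw [h]
      push_cast
      rw [one_mul]
      field_simp
      ring
    · rw [h]
      push_cast
      rw [neg_one_mul, sub_neg_eq_add]
      field_simp
      ring

theorem norm_dFactor_sub_one_le (N : ℕ) {α β : ℂ} (hα : 1 < α.re) (hβ : 1 < β.re) {p : ℕ}
    (hp : 0 < p) :
    ‖(p : ℂ) ^ (-α - 2 * β) * (1 - (p : ℂ) ^ (-1 - α) +
      ((jacobiSym (p : ℤ) N : ℤ) : ℂ) * (p : ℂ) ^ (-1 - α - β))‖ ≤ (p : ℝ) ^ (-β.re) * 3 := by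
  have hp1 : (1 : ℝ) ≤ p := by exact_mod_cast hp
  have hle {s : ℂ} (hs : s.re ≤ 0) : ‖(p : ℂ) ^ s‖ ≤ 1 := by
    rw [norm_natCast_cpow_of_pos hp]
    exact Real.rpow_le_one_of_one_le_of_nonpos hp1 hs
  rw [norm_mul]
  refine mul_le_mul ?_ ?_ (norm_nonneg _) (by positivity)
  · rw [norm_natCast_cpow_of_pos hp]
    refine Real.rpow_le_rpow_of_exponent_le hp1 ?_
    simp
    linarith
  · have h1 : ‖(p : ℂ) ^ (-1 - α)‖ ≤ 1 := hle (by simp; linarith)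
    have h2 : ‖(p : ℂ) ^ (-1 - α - β)‖ ≤ 1 := hle (by simp; linarith)
    have h3 := mul_le_one₀ (norm_jacobiSym_le_one p N) (norm_nonneg _) h2
    rw [← norm_mul] at h3
    calc _ ≤ ‖(1 : ℂ) - (p : ℂ) ^ (-1 - α)‖ + _ := norm_add_le _ _
      _ ≤ (‖(1 : ℂ)‖ + ‖(p : ℂ) ^ (-1 - α)‖) + _ := by gcongr; exact norm_sub_le _ _
      _ ≤ 3 := by rw [norm_one]; linarith

theorem multipliable_dFactor (N : ℕ) {α β : ℂ} (hα : 1 < α.re) (hβ : 1 < β.re) :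
    Multipliable fun p : {p : ℕ // p.Prime ∧ Odd p} ↦ dFactor N α β p := by
  refine multipliable_one_add_of_summable (Summable.of_nonneg_of_le (fun _ ↦ norm_nonneg _)
    (fun p ↦ norm_dFactor_sub_one_le N hα hβ p.2.1.pos) ?_)
  exact ((Real.summable_nat_rpow.mpr (by linarith)).comp_injective
    Subtype.val_injective).mul_right 3

theorem hasProd_jacobiSym (N : ℕ) {β : ℂ} (hβ : 1 < β.re) :
    HasProd (fun p : Nat.Primes ↦
        (1 - ((jacobiSym ((p : ℕ) : ℤ) N : ℤ) : ℂ) * ((p : ℕ) : ℂ) ^ (-β))⁻¹)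
      (∑' n : ℕ, ((jacobiSym (n : ℤ) N : ℤ) : ℂ) * (n : ℂ) ^ (-β)) := by
  have hβ0 : -β ≠ 0 := fun h ↦ by
    have := congrArg Complex.re h
    simp at this
    linarith
  let f : ℕ →*₀ ℂ :=
    { toFun n := ((jacobiSym (n : ℤ) N : ℤ) : ℂ) * (n : ℂ) ^ (-β)
      map_zero' := by simp [zero_cpow hβ0]
      map_one' := by simp
      map_mul' m n := by
        push_cast
        rw [natCast_mul_natCast_cpow, jacobiSym.mul_left]
        push_cast
        ring }
  refine EulerProduct.eulerProduct_completely_multiplicative_hasProd (f := f) ?_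
  refine Summable.of_nonneg_of_le (fun _ ↦ norm_nonneg _) (fun n ↦ ?_)
    (Real.summable_nat_rpow.mpr (by linarith : -β.re < -1))
  rcases n.eq_zero_or_pos with rfl | hn
  · rw [map_zero, norm_zero]
    positivity
  · change ‖((jacobiSym (n : ℤ) N : ℤ) : ℂ) * (n : ℂ) ^ (-β)‖ ≤ _
    rw [norm_mul, norm_natCast_cpow_of_pos hn, neg_re]
    exact mul_le_of_le_one_left (by positivity) (norm_jacobiSym_le_one n N)

theorem hasProd_dFactor_odd (N : ℕ) {α β : ℂ} (hα : 1 < α.re) (hβ : 1 < β.re) :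
    HasProd (fun p : Nat.Primes ↦ if Odd (p : ℕ) then dFactor N α β p else 1)
      (∏' p : {p : ℕ // p.Prime ∧ Odd p}, dFactor N α β p) := by
  have hinj : Function.Injective
      fun p : {p : ℕ // p.Prime ∧ Odd p} ↦ (⟨p, p.2.1⟩ : Nat.Primes) :=
    fun a b h ↦ Subtype.ext (congrArg (fun q : Nat.Primes ↦ (q : ℕ)) h)
  refine (hinj.hasProd_iff fun p hp ↦ if_neg fun hodd ↦ hp ⟨⟨p, p.2, hodd⟩, rfl⟩).mp ?_
  convert (multipliable_dFactor N hα hβ).hasProd using 2 with p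
  exact if_pos p.2.2

theorem hasProd_ite_dvd {N : ℕ} (hN : N ≠ 0) (f : ℕ → ℂ) :
    HasProd (fun p : Nat.Primes ↦ if (p : ℕ) ∣ N then f p else 1)
      (∏ p ∈ N.primeFactors, f p) := by
  have hinj : Function.Injective
      fun p : N.primeFactors ↦ (⟨p, Nat.prime_of_mem_primeFactors p.2⟩ : Nat.Primes) :=
    fun a b h ↦ Subtype.ext (congrArg (fun q : Nat.Primes ↦ (q : ℕ)) h)
  refine (hinj.hasProd_iff fun p hp ↦ if_neg fun hdvd ↦
    hp ⟨⟨p, p.2.mem_primeFactors hdvd hN⟩, rfl⟩).mp ?_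
  exact (N.primeFactors.hasProd f).congr_fun fun p ↦
    if_pos (Nat.dvd_of_mem_primeFactors p.2)

theorem hasProd_ite_eq_two (a : ℂ) :
    HasProd (fun p : Nat.Primes ↦ if (p : ℕ) = 2 then a else 1) a := by
  have h := hasProd_single (f := fun p : Nat.Primes ↦ if (p : ℕ) = 2 then a else 1)
    ⟨2, Nat.prime_two⟩ fun p hp ↦ if_neg fun h ↦ hp (Subtype.ext h)
  simpa using h

theorem hasSum_zSummand {N : ℕ} (hN : Odd N) {α β : ℂ} (hα : 1 < α.re) (hβ : 1 < β.re) :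
    HasSum (zSummand N α β)
      ((∑' n : ℕ, ((jacobiSym (n : ℤ) N : ℤ) : ℂ) * (n : ℂ) ^ (-β)) *
        riemannZeta (2 * α + 2 * β) * (1 - (2 : ℂ) ^ (-2 * α - 2 * β)) *
        (∏' p : {p : ℕ // p.Prime ∧ Odd p}, dFactor N α β p) *
        (1 - ((jacobiSym 2 N : ℤ) : ℂ) * (2 : ℂ) ^ (-β)) *
        ∏ p ∈ N.primeFactors, ramifiedFactor α β p) := by
  have hN0 : N ≠ 0 := hN.pos.ne'
  have hZ := (summable_zSummand N hα hβ).hasSum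
  have hF := hasSum_factorizationSum_pairWeight hZ
  have hbi := isBimultiplicative_pairWeight N α β
  have hE := EulerProduct.eulerProduct_hasProd hbi.factorizationSum_one hbi.factorizationSum_mul
    hF.summable.norm (factorizationSum_zero _)
  rw [hF.tsum_eq] at hE
  have hre : 1 < (2 * α + 2 * β).re := by
    simp
    linarith
  have hR := ((((hasProd_jacobiSym N hβ).mul (riemannZeta_eulerProduct_hasProd hre)).mul
    (hasProd_ite_eq_two (1 - (2 : ℂ) ^ (-2 * α - 2 * β)))).mul
    (hasProd_dFactor_odd N hα hβ)).mul
    (hasProd_ite_eq_two (1 - ((jacobiSym 2 N : ℤ) : ℂ) * (2 : ℂ) ^ (-β))) |>.mul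
    (hasProd_ite_dvd hN0 (ramifiedFactor α β))
  convert hZ using 1
  refine hR.unique ?_
  convert hE using 2 with p
  obtain ⟨p, hp⟩ := p
  rcases hp.eq_two_or_odd' with rfl | hodd
  · have hndvd : ¬ 2 ∣ N := fun h ↦ Nat.not_even_iff_odd.mpr hN (even_iff_two_dvd.mpr h)
    have hnorm {s : ℂ} (hs : 1 < s.re) : ‖(2 : ℂ) ^ (-s)‖ < 1 := by
      have := norm_natCast_cpow_of_pos two_pos (-s)
      rw [Nat.cast_ofNat] at this
      rw [this, neg_re]
      exact Real.rpow_lt_one_of_one_lt_of_neg (by norm_num) (by linarith)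
    have h1 := one_sub_ne_zero_of_norm_lt_one (hnorm hre)
    have h2 : 1 - ((jacobiSym 2 N : ℤ) : ℂ) * (2 : ℂ) ^ (-β) ≠ 0 := by
      refine one_sub_ne_zero_of_norm_lt_one ?_
      rw [norm_mul]
      exact mul_lt_one_of_nonneg_of_lt_one_right (norm_jacobiSym_le_one 2 N) (norm_nonneg _)
        (hnorm hβ)
    rw [show -2 * α - 2 * β = -(2 * α + 2 * β) by ring]
    simp only [factorizationSum_pairWeight_two_pow, tsum_ite_eq, if_true, hndvd, if_false,
      Nat.cast_ofNat, show ¬ Odd 2 by decide]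
    generalize (2 : ℂ) ^ (-(2 * α + 2 * β)) = z at h1 ⊢
    field_simp
  · have hne : p ≠ 2 := fun h ↦ by subst h; exact absurd hodd (by decide)
    simp only [tsum_factorizationSum_pairWeight_prime_pow hN0 hα hβ hp hodd, hne, hodd, if_true,
      if_false, mul_one]

/-- the Euler-product evaluation of the multiple Dirichlet series
`Z_{k,ℓ}(α,β)` attached to the Jacobi character `χ(n) = (n/kℓ)`, for `Re α > 1`,
`Re β > 1`:
`Z_{k,ℓ}(α,β) = L(β,χ) ζ(2α+2β) (1−2^{−2α−2β}) D(α,β,χ) (1−χ(2)2^{−β})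
  ∏_{p | kℓ} (1−p^{−1−2α−2β})/(1+p^{−α−2β}−p^{−1−2α−2β})`. -/
theorem Z_kl_euler_product (k l : ℕ) (hk : Odd k) (hl : Odd l)
    (hkpos : 0 < k) (hlpos : 0 < l)
    (α β : ℂ) (hα : 1 < α.re) (hβ : 1 < β.re) :
    HasSum (fun x : ℕ × ℕ × ℕ × ℕ × ℕ =>
      match x with
      | (r₁, r₂, g₁, g₂, q) =>
        if Odd r₁ ∧ Odd r₂ ∧ g₁ ∣ r₁ ^ 2 ∧ g₂ ∣ r₂ ^ 2 ∧
            Nat.Coprime (r₂ ^ 2 / g₂) (k * l) ∧ Squarefree q ∧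
            Nat.Coprime q (2 * r₂) ∧ (∀ p ∈ r₁.primeFactors, p ∣ q) then
          ((jacobiSym (q : ℤ) (k * l) : ℤ) : ℂ) *
            (∏ p ∈ r₂.primeFactors.filter fun p => ¬ p ∣ (r₂ ^ 2 / g₂), (1 - 1 / (p : ℂ))) *
            (q : ℂ) ^ (-β) * ((r₁ * r₂ : ℕ) : ℂ) ^ (-2 * β) *
            ((g₁ * g₂ : ℕ) : ℂ) ^ (-α)
        else 0)
      ((∑' n : ℕ, ((jacobiSym (n : ℤ) (k * l) : ℤ) : ℂ) * (n : ℂ) ^ (-β)) *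
        riemannZeta (2 * α + 2 * β) * (1 - (2 : ℂ) ^ (-2 * α - 2 * β)) *
        (∏' p : {p : ℕ // p.Prime ∧ Odd p},
          (1 + ((p : ℕ) : ℂ) ^ (-α - 2 * β) *
            (1 - ((p : ℕ) : ℂ) ^ (-1 - α) +
              ((jacobiSym ((p : ℕ) : ℤ) (k * l) : ℤ) : ℂ) * ((p : ℕ) : ℂ) ^ (-1 - α - β)))) *
        (1 - ((jacobiSym 2 (k * l) : ℤ) : ℂ) * (2 : ℂ) ^ (-β)) *
        ∏ p ∈ (k * l).primeFactors,
          (1 - (p : ℂ) ^ (-1 - 2 * α - 2 * β)) /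
            (1 + (p : ℂ) ^ (-α - 2 * β) - (p : ℂ) ^ (-1 - 2 * α - 2 * β))) := by
  exact hasSum_zSummand (hk.mul hl) hα hβ
end
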